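/- Let r₁,…,r_{n₂} be positive integers with r̄ = r₁+⋯+r_{n₂}. Let M = blkdiag(M₁,…,M_{n₂}), N = blkdiag(N₁,…,N_{n₂}), Φ = blkdiag(Φ₁,…,Φ_{n₂}), Γ = blkdiag(Γ₁,…,Γ_{n₂}), T = blkdiag(T₁,…,T_{n₂}) with M_i, Φ_i, T_i ∈ ℝ^{r_i×r_i}, N_i ∈ ℝ^{r_i×1}, Γ_i ∈ ℝ^{1×r_i}, M Hurwitz, T invertible, and T Φ − M T = N Γ; set Ψ := Γ T⁻¹ = blkdiag(Ψ₁,…,Ψ_{n₂}). Let g : [0,∞) → ℝ^{n₂} be continuous and let differentiable functions ϱ, η, θ : [0,∞) → ℝ^{r̄} and x₂, x̂₂ : [0,∞) → ℝ^{n₂} satisfy: ϱ̇ = T Φ T⁻¹ ϱ with ϱ and ϱ̇ uniformly bounded; ẋ₂ = g(t) − Ψ ϱ; η̇ = M η + N g(t) − M N x₂; and, with ϱ̂ := η − N x₂ partitioned into blocks ϱ̂_i ∈ ℝ^{r_i}, the observer equations x̂₂̇ = g(t) − M(ϱ̂) θ + K (x̂₂ − x₂) and θ̇ = Λ M(ϱ̂)ᵀ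 P (x̂₂ − x₂), where K ∈ ℝ^{n₂×n₂} is Hurwitz, P ∈ ℝ^{n₂×n₂} is symmetric positive definite with Kᵀ P + P K = −I, and Λ ∈ ℝ^{r̄×r̄} is symmetric positive definite. Define d := −Ψ ϱ and d̂ := −M(ϱ̂) θ. Then, for all initial conditions, x̂₂(t) − x₂(t) → 0 and d̂(t) − d(t) → 0 as t → ∞. -/

import Mathlib

open Matrix Filter Topology

/-- A real square matrix is Hurwitz if all of its complex eigenvalues have
negative real part. -/
def Hurwitz {n : Type*} [Fintype n] [DecidableEq n] (A : Matrix n n ℝ) : Prop :=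
  ∀ μ ∈ spectrum ℂ (A.map (algebraMap ℝ ℂ)), μ.re < 0

/-- Block index set `Σ i, Fin (r i)` for stacked vectors `col(v₁,…,v_{n₂})`
with `v_i ∈ ℝ^{r i}`. -/
abbrev BIdx {n₂ : ℕ} (r : Fin n₂ → ℕ) := Σ i : Fin n₂, Fin (r i)

/-- A square matrix indexed by `BIdx r` is block diagonal. -/
def IsBlkDiag {n₂ : ℕ} {r : Fin n₂ → ℕ} (A : Matrix (BIdx r) (BIdx r) ℝ) : Prop :=
  ∀ a b : BIdx r, a.1 ≠ b.1 → A a b = 0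

/-- `N = blkdiag(N₁,…,N_{n₂})` with `N_i ∈ ℝ^{r_i × 1}`: the `j`-th column is
supported on the `j`-th block. -/
def IsBlkCol {n₂ : ℕ} {r : Fin n₂ → ℕ} (N : Matrix (BIdx r) (Fin n₂) ℝ) : Prop :=
  ∀ (a : BIdx r) (j : Fin n₂), a.1 ≠ j → N a j = 0

/-- `Γ = blkdiag(Γ₁,…,Γ_{n₂})` with `Γ_i ∈ ℝ^{1 × r_i}`: the `j`-th row is
supported on the `j`-th block. -/
def IsBlkRow {n₂ : ℕ} {r : Fin n₂ → ℕ} (Γ : Matrix (Fin n₂) (BIdx r) ℝ) : Prop :=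
  ∀ (j : Fin n₂) (a : BIdx r), j ≠ a.1 → Γ j a = 0

/-- `𝓜(ϱ) = blkdiag(ϱ₁ᵀ,…,ϱ_{n₂}ᵀ) ∈ ℝ^{n₂ × r̄}` built from a stacked vector. -/
def MMat {n₂ : ℕ} {r : Fin n₂ → ℕ} (v : EuclideanSpace ℝ (BIdx r)) :
    Matrix (Fin n₂) (BIdx r) ℝ :=
  Matrix.of fun i a => if a.1 = i then v a else 0

/-- `𝓒(Ψ) = col(Ψ₁ᵀ,…,Ψ_{n₂}ᵀ) ∈ ℝ^{r̄}` built from a block-row matrix. -/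
noncomputable def CVec {n₂ : ℕ} {r : Fin n₂ → ℕ} (Ψ : Matrix (Fin n₂) (BIdx r) ℝ) :
    EuclideanSpace ℝ (BIdx r) :=
  (WithLp.equiv 2 _).symm fun a => Ψ a.1 a

open scoped RealInnerProductSpace Polynomial
open Polynomial (aeval X C)

theorem exists_norm_le_exp_of_hasDerivAt_smul_add {F : Type*} [NormedAddCommGroup F]
    [NormedSpace ℂ F] {y f : ℝ → F} {μ : ℂ} {a C : ℝ} (hμ : μ.re < -a)
    (hy : ∀ t ≥ (0:ℝ), HasDerivAt y (μ • y t + f t) t)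
    (hf : ∀ t ≥ (0:ℝ), ‖f t‖ ≤ C * Real.exp (-a * t)) :
    ∃ C', ∀ t ≥ (0:ℝ), ‖y t‖ ≤ C' * Real.exp (-a * t) := by
  set b : ℝ := -μ.re - a with hb
  have hbpos : 0 < b := by rw [hb]; linarith
  have hC : 0 ≤ C := by
    have := (norm_nonneg _).trans (hf 0 le_rfl)
    simpa using this
  have hexp : ∀ t : ℝ, HasDerivAt (fun s : ℝ => Complex.exp (-μ * s))
      (Complex.exp (-μ * t) * -μ) t := by
    intro t
    have h1 : HasDerivAt (fun s : ℝ => -μ * (s : ℂ)) (-μ) t := by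
      simpa using (Complex.ofRealCLM.hasDerivAt (x := t)).const_mul (-μ)
    exact h1.cexp
  have hw : ∀ t ≥ (0:ℝ), HasDerivAt (fun s : ℝ => Complex.exp (-μ * s) • y s)
      (Complex.exp (-μ * t) • f t) t := by
    intro t ht
    refine ((hexp t).smul (hy t ht)).congr_deriv ?_
    module
  have hnexp : ∀ t : ℝ, ‖Complex.exp (-μ * t)‖ = Real.exp (-μ.re * t) := by
    intro t
    rw [Complex.norm_exp]
    simp
  have hB : ∀ t : ℝ, HasDerivAt (fun s : ℝ => ‖y 0‖ + C / b * Real.exp (b * s))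
      (C * Real.exp (b * t)) t := by
    intro t
    have h1 : HasDerivAt (fun s : ℝ => b * s) b t := by
      simpa using (hasDerivAt_id t).const_mul b
    refine ((h1.exp.const_mul (C / b)).const_add ‖y 0‖).congr_deriv ?_
    field_simp
  have key : ∀ t ≥ (0:ℝ), ‖Complex.exp (-μ * t) • y t‖ ≤ ‖y 0‖ + C / b * Real.exp (b * t) := by
    intro t ht
    refine image_norm_le_of_norm_deriv_right_le_deriv_boundary
      (f := fun s : ℝ => Complex.exp (-μ * s) • y s)
      (f' := fun s => Complex.exp (-μ * s) • f s)
      (a := 0) (b := t) (B := fun s => ‖y 0‖ + C / b * Real.exp (b * s))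
      (B' := fun s => C * Real.exp (b * s))
      ?_ ?_ ?_ ?_ ?_ (Set.right_mem_Icc.2 ht)
    · intro s hs
      exact (hw s hs.1).continuousAt.continuousWithinAt
    · intro s hs
      exact (hw s hs.1).hasDerivWithinAt
    · have : 0 ≤ C / b := by positivity
      simpa using this
    · exact hB
    · intro s hs
      rw [norm_smul, hnexp]
      calc _ ≤ Real.exp (-μ.re * s) * (C * Real.exp (-a * s)) := by
            gcongr; exact hf s hs.1
        _ = C * (Real.exp (-μ.re * s) * Real.exp (-a * s)) := by ring
        _ = C * Real.exp (b * s) := by rw [← Real.exp_add, hb]; ring_nf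
  refine ⟨‖y 0‖ + C / b, fun t ht => ?_⟩
  have h1 := key t ht
  rw [norm_smul, hnexp] at h1
  have h2 : Real.exp (μ.re * t) * Real.exp (-μ.re * t) = 1 := by
    rw [← Real.exp_add]; simp
  have h3 : Real.exp (μ.re * t) * Real.exp (b * t) = Real.exp (-a * t) := by
    rw [← Real.exp_add, hb]; ring_nf
  have h4 : Real.exp (μ.re * t) ≤ Real.exp (-a * t) := by
    gcongr
  calc ‖y t‖ = Real.exp (μ.re * t) * (Real.exp (-μ.re * t) * ‖y t‖) := by
        rw [← mul_assoc, h2, one_mul]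
    _ ≤ Real.exp (μ.re * t) * (‖y 0‖ + C / b * Real.exp (b * t)) := by gcongr
    _ = Real.exp (μ.re * t) * ‖y 0‖ + C / b * Real.exp (-a * t) := by rw [← h3]; ring
    _ ≤ Real.exp (-a * t) * ‖y 0‖ + C / b * Real.exp (-a * t) := by gcongr
    _ = _ := by ring

theorem exists_norm_le_exp_of_aeval_prod_eq_zero {F : Type*} [NormedAddCommGroup F]
    [NormedSpace ℂ F] [FiniteDimensional ℂ F] (A : F →ₗ[ℂ] F) {a : ℝ} (s : Multiset ℂ) (hs : ∀ μ ∈ s, μ.re < -a)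
    (z : ℝ → F) (hz : ∀ t ≥ (0:ℝ), HasDerivAt z (A (z t)) t)
    (h0 : ∀ t ≥ (0:ℝ), aeval A (s.map fun μ => X - C μ).prod (z t) = 0) :
    ∃ c, ∀ t ≥ (0:ℝ), ‖z t‖ ≤ c * Real.exp (-a * t) := by
  induction s using Multiset.induction_on generalizing z with
  | empty =>
    refine ⟨0, fun t ht => ?_⟩
    have : z t = 0 := by simpa using h0 t ht
    simp [this]
  | cons μ s ih =>
    obtain ⟨c, hc⟩ := ih (fun ν hν => hs ν (Multiset.mem_cons_of_mem hν))
      (fun t => A (z t) - μ • z t)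
      (fun t ht => by
        have h1 := ((A - μ • LinearMap.id).toContinuousLinearMap.restrictScalars ℝ).hasFDerivAt
          |>.comp_hasDerivAt t (hz t ht)
        refine h1.congr_deriv ?_
        simp)
      (fun t ht => by
        have := h0 t ht
        rw [Multiset.map_cons, Multiset.prod_cons, mul_comm, map_mul,
          Module.End.mul_apply] at this
        simpa [Algebra.algebraMap_eq_smul_one] using this)
    refine exists_norm_le_exp_of_hasDerivAt_smul_add (hs μ (Multiset.mem_cons_self μ s))
      (f := fun t => A (z t) - μ • z t) (fun t ht => ?_) hc
    refine (hz t ht).congr_deriv ?_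
    simp

theorem Hurwitz.exists_norm_le_exp {n : Type*} [Fintype n] [DecidableEq n] {A : Matrix n n ℝ}
    (hA : Hurwitz A) {ζ : ℝ → EuclideanSpace ℝ n}
    (hζ : ∀ t ≥ (0:ℝ), HasDerivAt ζ (Matrix.toEuclideanLin A (ζ t)) t) :
    ∃ a > 0, ∃ c, ∀ t ≥ (0:ℝ), ‖ζ t‖ ≤ c * Real.exp (-a * t) := by
  set L : (n → ℂ) →ₗ[ℂ] (n → ℂ) := Matrix.toLin' (A.map (algebraMap ℝ ℂ)) with hL
  have hroots : ∀ μ ∈ L.charpoly.roots.toFinset, μ.re < 0 := by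
    intro μ hμ
    rw [Multiset.mem_toFinset] at hμ
    have h1 : L.charpoly.IsRoot μ := (Polynomial.mem_roots'.1 hμ).2
    have h2 := (Module.End.hasEigenvalue_iff_isRoot_charpoly L μ).2 h1
    have h3 := h2.mem_spectrum
    rw [hL, Matrix.spectrum_toLin'] at h3
    exact hA μ h3
  have hev : ∀ᶠ a : ℝ in 𝓝[>] 0, ∀ μ ∈ L.charpoly.roots.toFinset, μ.re < -a := by
    rw [Filter.eventually_all_finset]
    intro μ hμ
    have := hroots μ hμ
    have h2 : Tendsto (fun a : ℝ => -a) (𝓝[>] 0) (𝓝 0) := by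
      have : Tendsto (fun a : ℝ => -a) (𝓝 0) (𝓝 (-0)) := continuous_neg.tendsto 0
      rw [neg_zero] at this
      exact this.mono_left nhdsWithin_le_nhds
    exact h2.eventually (lt_mem_nhds this)
  obtain ⟨a, ha, hapos⟩ := (hev.and self_mem_nhdsWithin).exists
  refine ⟨a, hapos, ?_⟩
  set J : EuclideanSpace ℝ n →L[ℝ] (n → ℂ) :=
    ContinuousLinearMap.pi fun i => Complex.ofRealCLM.comp (EuclideanSpace.proj i) with hJ
  obtain ⟨c, hc⟩ := exists_norm_le_exp_of_aeval_prod_eq_zero L L.charpoly.roots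
    (fun μ hμ => ha μ (Multiset.mem_toFinset.2 hμ)) (fun t => J (ζ t))
    (fun t ht => by
      refine (J.hasFDerivAt.comp_hasDerivAt t (hζ t ht)).congr_deriv ?_
      ext i
      simp [hJ, hL, Matrix.toLpLin_apply, Matrix.mulVec, dotProduct])
    (fun t ht => by
      rw [← (IsAlgClosed.splits L.charpoly).eq_prod_roots_of_monic L.charpoly_monic]
      simp [LinearMap.aeval_self_charpoly])
  refine ⟨Real.sqrt (Fintype.card n) * c, fun t ht => ?_⟩
  have h1 := hc t ht
  have h2 : ∀ i, ‖ζ t i‖ ≤ c * Real.exp (-a * t) := by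
    intro i
    refine le_trans ?_ h1
    have := norm_le_pi_norm (J (ζ t)) i
    simpa [hJ] using this
  have h0 : 0 ≤ c * Real.exp (-a * t) := (norm_nonneg _).trans h1
  rw [EuclideanSpace.norm_eq, mul_assoc]
  rw [← Real.sqrt_sq h0, ← Real.sqrt_mul (by positivity)]
  refine Real.sqrt_le_sqrt ?_
  calc ∑ i, ‖ζ t i‖ ^ 2 ≤ ∑ i : n, (c * Real.exp (-a * t)) ^ 2 := by
        gcongr with i _; exact h2 i
    _ = _ := by simp

section BddLip

variable {E F G : Type*} [NormedAddCommGroup E] [NormedAddCommGroup F] [NormedAddCommGroup G]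

/-- `f` is bounded and Lipschitz on `[0, ∞)`. -/
def BddLip (f : ℝ → E) : Prop :=
  ∃ C, (∀ t ≥ (0:ℝ), ‖f t‖ ≤ C) ∧ ∀ s ≥ (0:ℝ), ∀ t ≥ (0:ℝ), ‖f s - f t‖ ≤ C * |s - t|

theorem BddLip.add {f g : ℝ → E} (hf : BddLip f) (hg : BddLip g) :
    BddLip fun t => f t + g t := by
  obtain ⟨C, hC, hC'⟩ := hf
  obtain ⟨D, hD, hD'⟩ := hg
  refine ⟨C + D, fun t ht => norm_add_le_of_le (hC t ht) (hD t ht), fun s hs t ht => ?_⟩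
  rw [add_sub_add_comm, add_mul]
  exact norm_add_le_of_le (hC' s hs t ht) (hD' s hs t ht)

theorem BddLip.neg {f : ℝ → E} (hf : BddLip f) : BddLip fun t => -f t := by
  obtain ⟨C, hC, hC'⟩ := hf
  refine ⟨C, fun t ht => by simpa using hC t ht, fun s hs t ht => ?_⟩
  rw [← neg_sub', norm_neg]
  exact hC' s hs t ht

theorem BddLip.sub {f g : ℝ → E} (hf : BddLip f) (hg : BddLip g) :
    BddLip fun t => f t - g t := by
  simpa only [sub_eq_add_neg] using hf.add hg.neg

theorem BddLip.bilin [NormedSpace ℝ E] [NormedSpace ℝ F] [NormedSpace ℝ G]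
    (B : E →L[ℝ] F →L[ℝ] G) {f : ℝ → E} {g : ℝ → F} (hf : BddLip f) (hg : BddLip g) :
    BddLip fun t => B (f t) (g t) := by
  obtain ⟨C, hC, hC'⟩ := hf
  obtain ⟨D, hD, hD'⟩ := hg
  have hC0 : 0 ≤ C := (norm_nonneg _).trans (hC 0 le_rfl)
  have hD0 : 0 ≤ D := (norm_nonneg _).trans (hD 0 le_rfl)
  have hB := norm_nonneg B
  refine ⟨2 * (‖B‖ * C * D), fun t ht => ?_, fun s hs t ht => ?_⟩
  · calc ‖B (f t) (g t)‖ ≤ ‖B‖ * ‖f t‖ * ‖g t‖ := B.le_opNorm₂ _ _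
      _ ≤ ‖B‖ * C * D := by gcongr; exacts [hC t ht, hD t ht]
      _ ≤ _ := by linarith [mul_nonneg (mul_nonneg hB hC0) hD0]
  · have h : B (f s) (g s) - B (f t) (g t) = B (f s - f t) (g s) + B (f t) (g s - g t) := by
      simp
    rw [h]
    calc _ ≤ ‖B‖ * ‖f s - f t‖ * ‖g s‖ + ‖B‖ * ‖f t‖ * ‖g s - g t‖ :=
          norm_add_le_of_le (B.le_opNorm₂ _ _) (B.le_opNorm₂ _ _)
      _ ≤ ‖B‖ * (C * |s - t|) * D + ‖B‖ * C * (D * |s - t|) := by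
          gcongr; exacts [hC' s hs t ht, hD s hs, hC t ht, hD' s hs t ht]
      _ = _ := by ring

theorem BddLip.clm [NormedSpace ℝ E] [NormedSpace ℝ F] (A : E →L[ℝ] F) {f : ℝ → E}
    (hf : BddLip f) : BddLip fun t => A (f t) := by
  obtain ⟨C, hC, hC'⟩ := hf
  refine ⟨‖A‖ * C, fun t ht => ?_, fun s hs t ht => ?_⟩
  · exact A.le_of_opNorm_le_of_le le_rfl (hC t ht)
  · rw [← map_sub, mul_assoc]
    exact A.le_of_opNorm_le_of_le le_rfl (hC' s hs t ht)

theorem BddLip.of_hasDerivAt [NormedSpace ℝ E] {f f' : ℝ → E}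
    (hf : ∀ t ≥ (0:ℝ), HasDerivAt f (f' t) t) {C D : ℝ} (hC : ∀ t ≥ (0:ℝ), ‖f t‖ ≤ C)
    (hD : ∀ t ≥ (0:ℝ), ‖f' t‖ ≤ D) : BddLip f := by
  refine ⟨max C D, fun t ht => (hC t ht).trans (le_max_left _ _), fun s hs t ht => ?_⟩
  refine (Convex.norm_image_sub_le_of_norm_hasDerivWithin_le (s := Set.Ici (0:ℝ)) (f' := f')
    (fun x hx => (hf x hx).hasDerivWithinAt) hD (convex_Ici 0) ht hs).trans ?_
  rw [Real.norm_eq_abs]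
  gcongr
  exact le_max_right _ _

/-- **Barbalat's lemma**: if `f` converges and its derivative is Lipschitz, then the derivative
tends to zero. -/
theorem BddLip.tendsto_deriv_zero [NormedSpace ℝ E] {f f' : ℝ → E} {l : E} (hf' : BddLip f')
    (hf : ∀ t ≥ (0:ℝ), HasDerivAt f (f' t) t) (hl : Tendsto f atTop (𝓝 l)) :
    Tendsto f' atTop (𝓝 0) := by
  obtain ⟨C, hC, hC'⟩ := hf'
  have hC0 : 0 ≤ C := (norm_nonneg _).trans (hC 0 le_rfl)
  rw [Metric.tendsto_nhds]
  intro ε hε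
  set h : ℝ := ε / (2 * (C + 1)) with hh
  have hpos : 0 < h := by positivity
  have hCh : C * h < ε / 2 := by
    rw [hh, mul_div_assoc', div_lt_div_iff₀ (by positivity) (by positivity)]
    nlinarith
  have hlim : Tendsto (fun t => f (t + h) - f t) atTop (𝓝 0) := by
    simpa using (hl.comp (tendsto_atTop_add_const_right atTop h tendsto_id)).sub hl
  filter_upwards [eventually_ge_atTop 0,
    (Metric.tendsto_nhds.1 hlim) (h * (ε / 2)) (by positivity)] with t ht hclose
  rw [dist_zero_right] at hclose ⊢
  have hmv : ‖(f (t + h) - (t + h) • f' t) - (f t - t • f' t)‖ ≤ C * h * ‖t + h - t‖ := by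
    refine Convex.norm_image_sub_le_of_norm_hasDerivWithin_le (s := Set.Icc t (t + h))
      (f := fun x => f x - x • f' t) (f' := fun x => f' x - f' t) (fun x hx => ?_) (fun x hx => ?_)
      (convex_Icc _ _) (Set.left_mem_Icc.2 (by linarith)) (Set.right_mem_Icc.2 (by linarith))
    · have h1 : HasDerivAt (fun x : ℝ => x • f' t) (f' t) x := by
        simpa using (hasDerivAt_id x).smul_const (f' t)
      exact ((hf x (ht.trans hx.1)).sub h1).hasDerivWithinAt
    · refine (hC' x (ht.trans hx.1) t ht).trans ?_
      gcongr
      rw [abs_of_nonneg (by linarith [hx.1])]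
      linarith [hx.2]
  have heq : h • f' t = (f (t + h) - f t)
      - ((f (t + h) - (t + h) • f' t) - (f t - t • f' t)) := by module
  have h2 : h * ‖f' t‖ < h * ε := by
    calc h * ‖f' t‖ = ‖h • f' t‖ := by rw [norm_smul, Real.norm_of_nonneg hpos.le]
      _ ≤ ‖f (t + h) - f t‖ + C * h * ‖t + h - t‖ := by
          rw [heq]; exact norm_sub_le_of_le le_rfl hmv
      _ = ‖f (t + h) - f t‖ + C * h * h := by
          rw [add_sub_cancel_left, Real.norm_of_nonneg hpos.le]
      _ < h * (ε / 2) + ε / 2 * h := by gcongr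
      _ = h * ε := by ring
  exact lt_of_mul_lt_mul_left h2 hpos.le

end BddLip

theorem exists_tendsto_of_hasDerivAt_nonpos {W W' : ℝ → ℝ}
    (hW : ∀ t ≥ (0:ℝ), HasDerivAt W (W' t) t) (hW' : ∀ t ≥ (0:ℝ), W' t ≤ 0)
    (h0 : ∀ t ≥ (0:ℝ), 0 ≤ W t) :
    (∀ t ≥ (0:ℝ), W t ≤ W 0) ∧ ∃ l, Tendsto W atTop (𝓝 l) := by
  have hanti : AntitoneOn W (Set.Ici 0) := by
    refine antitoneOn_of_deriv_nonpos (convex_Ici 0)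
      (fun t ht => (hW t ht).continuousAt.continuousWithinAt) ?_ ?_
    · intro t ht
      rw [interior_Ici] at ht
      exact (hW t (le_of_lt ht)).differentiableAt.differentiableWithinAt
    · intro t ht
      rw [interior_Ici] at ht
      rw [(hW t (le_of_lt ht)).deriv]
      exact hW' t (le_of_lt ht)
  refine ⟨fun t ht => hanti Set.self_mem_Ici ht ht, ?_⟩
  have h1 : Antitone fun t => W (max t 0) := fun s t hst =>
    hanti (Set.mem_Ici.2 (le_max_right _ _)) (Set.mem_Ici.2 (le_max_right _ _)) (max_le_max_right 0 hst)
  have h2 : BddBelow (Set.range fun t => W (max t 0)) := by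
    refine ⟨0, ?_⟩
    rintro _ ⟨t, rfl⟩
    exact h0 _ (le_max_right _ _)
  refine ⟨_, (tendsto_atTop_ciInf h1 h2).congr' ?_⟩
  filter_upwards [eventually_ge_atTop 0] with t ht
  rw [max_eq_left ht]

/-- Convergence of the error dynamics of an adaptive observer with regressor `σ`, perturbed by an
exponentially decaying term `ζ`. -/
theorem tendsto_zero_of_adaptive_error {E F : Type*} [NormedAddCommGroup E]
    [InnerProductSpace ℝ E] [NormedAddCommGroup F] [InnerProductSpace ℝ F]
    (B : E →L[ℝ] E →L[ℝ] F) (L : E →L[ℝ] F →L[ℝ] E) (S : E →L[ℝ] F) (K P : F →L[ℝ] F)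
    (G : E →L[ℝ] E) {p q a c : ℝ} (hp : 0 < p) (hq : 0 < q) (ha : 0 < a)
    (hPpos : ∀ x, p * ‖x‖ ^ 2 ≤ ⟪x, P x⟫) (hPsymm : ∀ x y, ⟪x, P y⟫ = ⟪P x, y⟫)
    (hGpos : ∀ x, q * ‖x‖ ^ 2 ≤ ⟪x, G x⟫) (hGsymm : ∀ x y, ⟪x, G y⟫ = ⟪G x, y⟫)
    (hKP : ∀ x, 2 * ⟪P x, K x⟫ = -‖x‖ ^ 2)
    (hL : ∀ v x w, ⟪G w, L v x⟫ = ⟪B v w, P x⟫)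
    {σ θ ζ : ℝ → E} {e : ℝ → F} (hσ : BddLip σ) (hζl : BddLip ζ)
    (hζ : ∀ t ≥ (0:ℝ), ‖ζ t‖ ≤ c * Real.exp (-a * t))
    (he : ∀ t ≥ (0:ℝ), HasDerivAt e (K (e t) - B (σ t) (θ t) - S (ζ t)) t)
    (hθ : ∀ t ≥ (0:ℝ), HasDerivAt θ (L (σ t) (e t)) t) :
    Tendsto e atTop (𝓝 0) ∧ Tendsto (fun t => B (σ t) (θ t) + S (ζ t)) atTop (𝓝 0) := by
  set k : ℝ := (‖P‖ * ‖S‖ * c) ^ 2 / a with hk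
  have hk0 : 0 ≤ k := by positivity
  set x : ℝ → ℝ := fun t => Real.exp (-a * t) with hx
  have hx' : ∀ t, HasDerivAt x (-a * x t) t := by
    intro t
    have h1 : HasDerivAt (fun s : ℝ => -a * s) (-a) t := by
      simpa using (hasDerivAt_id t).const_mul (-a)
    exact h1.exp.congr_deriv (mul_comm _ _)
  have hx1 : ∀ t ≥ (0:ℝ), ‖x t‖ ≤ 1 := by
    intro t ht
    rw [Real.norm_of_nonneg (Real.exp_pos _).le]
    exact Real.exp_le_one_iff.2 (by nlinarith)
  have hxl : BddLip x := by
    refine .of_hasDerivAt (D := a) (fun t _ => hx' t) hx1 (fun t ht => ?_)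
    rw [norm_mul, norm_neg, Real.norm_of_nonneg ha.le]
    exact mul_le_of_le_one_right ha.le (hx1 t ht)
  set W : ℝ → ℝ := fun t => ⟪e t, P (e t)⟫ + ⟪θ t, G (θ t)⟫ + k * (x t * x t) with hW_eq
  set W' : ℝ → ℝ := fun t =>
    -⟪e t, e t⟫ - (⟪P (e t), S (ζ t)⟫ + ⟪P (e t), S (ζ t)⟫)
      - (2 * a * k) * (x t * x t) with hWder_eq
  have hWd : ∀ t ≥ (0:ℝ), HasDerivAt W (W' t) t := by
    intro t ht
    have h1 := (he t ht).inner ℝ (P.hasFDerivAt.comp_hasDerivAt t (he t ht))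
    have h2 := (hθ t ht).inner ℝ (G.hasFDerivAt.comp_hasDerivAt t (hθ t ht))
    have h3 := ((hx' t).mul (hx' t)).const_mul k
    refine ((h1.add h2).add h3).congr_deriv ?_
    simp only [hWder_eq, Function.comp_apply]
    rw [hPsymm (e t), hGsymm (θ t), real_inner_comm (P (e t)), real_inner_comm (G (θ t)), hL,
      inner_sub_right, inner_sub_right, real_inner_comm (P (e t)) (B _ _),
      real_inner_self_eq_norm_sq]
    linear_combination hKP (e t)
  have hWle : ∀ t ≥ (0:ℝ), W' t ≤ -(‖e t‖ ^ 2 / 2) := by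
    intro t ht
    have h1 : |⟪P (e t), S (ζ t)⟫| ≤ ‖e t‖ * (‖P‖ * ‖S‖ * c * x t) := by
      calc _ ≤ ‖P (e t)‖ * ‖S (ζ t)‖ := abs_real_inner_le_norm _ _
        _ ≤ (‖P‖ * ‖e t‖) * (‖S‖ * (c * x t)) := by
            gcongr
            · exact P.le_opNorm _
            · exact S.le_of_opNorm_le_of_le le_rfl (hζ t ht)
        _ = _ := by ring
    have h2 : 2 * a * k * (x t * x t) = 2 * (‖P‖ * ‖S‖ * c * x t) ^ 2 := by
      rw [hk]; field_simp
    simp only [hWder_eq]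
    rw [h2, real_inner_self_eq_norm_sq]
    nlinarith [(abs_le.1 h1).1, sq_nonneg (‖e t‖ - 2 * (‖P‖ * ‖S‖ * c * x t))]
  have hPe : ∀ t, 0 ≤ ⟪e t, P (e t)⟫ := fun t => le_trans (by positivity) (hPpos _)
  have hGθ : ∀ t, 0 ≤ ⟪θ t, G (θ t)⟫ := fun t => le_trans (by positivity) (hGpos _)
  have hkx : ∀ t, 0 ≤ k * (x t * x t) := fun t => mul_nonneg hk0 (mul_self_nonneg _)
  obtain ⟨hW0, l, hl⟩ := exists_tendsto_of_hasDerivAt_nonpos hWd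
    (fun t ht => (hWle t ht).trans (by rw [neg_nonpos]; positivity))
    (fun t _ => add_nonneg (add_nonneg (hPe t) (hGθ t)) (hkx t))
  have hebd : ∀ t ≥ (0:ℝ), ‖e t‖ ≤ Real.sqrt (W 0 / p) := by
    intro t ht
    refine Real.le_sqrt_of_sq_le ?_
    rw [le_div_iff₀ hp]
    have := hW0 t ht
    simp only [hW_eq] at this ⊢
    linarith [hPpos (e t), hGθ t, hkx t]
  have hθbd : ∀ t ≥ (0:ℝ), ‖θ t‖ ≤ Real.sqrt (W 0 / q) := by
    intro t ht
    refine Real.le_sqrt_of_sq_le ?_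
    rw [le_div_iff₀ hq]
    have := hW0 t ht
    simp only [hW_eq] at this ⊢
    linarith [hGpos (θ t), hPe t, hkx t]
  obtain ⟨cσ, hcσ, -⟩ := id hσ
  obtain ⟨cζ, hcζ, -⟩ := id hζl
  have hel : BddLip e := by
    refine .of_hasDerivAt he hebd (fun t ht => ?_)
      (D := ‖K‖ * Real.sqrt (W 0 / p) + ‖B‖ * cσ * Real.sqrt (W 0 / q) + ‖S‖ * cζ)
    refine norm_sub_le_of_le (norm_sub_le_of_le ?_ ?_) ?_
    · exact K.le_of_opNorm_le_of_le le_rfl (hebd t ht)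
    · exact B.le_of_opNorm₂_le_of_le le_rfl (hcσ t ht) (hθbd t ht)
    · exact S.le_of_opNorm_le_of_le le_rfl (hcζ t ht)
  have hθl : BddLip θ := by
    refine .of_hasDerivAt hθ hθbd (fun t ht => ?_) (D := ‖L‖ * cσ * Real.sqrt (W 0 / p))
    exact L.le_of_opNorm₂_le_of_le le_rfl (hcσ t ht) (hebd t ht)
  have hPSl := BddLip.bilin (innerSL ℝ) (hel.clm P) (hζl.clm S)
  have hW'l : BddLip W' :=
    (((BddLip.bilin (innerSL ℝ) hel hel).neg).sub (hPSl.add hPSl)).sub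
      ((hxl.bilin (ContinuousLinearMap.mul ℝ ℝ) hxl).clm
        (ContinuousLinearMap.mul ℝ ℝ (2 * a * k)))
  have hW'0 := hW'l.tendsto_deriv_zero hWd hl
  have he0 : Tendsto e atTop (𝓝 0) := by
    have h1 : Tendsto (fun t => Real.sqrt (-2 * W' t)) atTop (𝓝 0) := by
      have := (hW'0.const_mul (-2)).sqrt
      simpa using this
    refine squeeze_zero_norm' ?_ h1
    filter_upwards [eventually_ge_atTop 0] with t ht
    exact Real.le_sqrt_of_sq_le (by linarith [hWle t ht])
  refine ⟨he0, ?_⟩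
  have he'l : BddLip fun t => K (e t) - B (σ t) (θ t) - S (ζ t) :=
    ((hel.clm K).sub (hσ.bilin B hθl)).sub (hζl.clm S)
  have h1 := he'l.tendsto_deriv_zero he he0
  have h2 : Tendsto (fun t => K (e t)) atTop (𝓝 0) := by
    simpa [Function.comp_def] using (K.continuous.tendsto 0).comp he0
  have h3 := h2.sub h1
  rw [sub_zero] at h3
  refine h3.congr fun t => ?_
  abel

theorem Matrix.PosDef.exists_mul_sq_norm_le_inner {n : Type*} [Fintype n] [DecidableEq n]
    {A : Matrix n n ℝ} (hA : A.PosDef) :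
    ∃ m > 0, ∀ x : EuclideanSpace ℝ n, m * ‖x‖ ^ 2 ≤ ⟪x, Matrix.toEuclideanLin A x⟫ := by
  have hpos : ∀ x : EuclideanSpace ℝ n, x ≠ 0 → 0 < ⟪x, Matrix.toEuclideanLin A x⟫ := by
    intro x hx
    have h := hA.dotProduct_mulVec_pos (x := x.ofLp) (by simpa using hx)
    rwa [EuclideanSpace.inner_eq_star_dotProduct, dotProduct_comm]
  rcases subsingleton_or_nontrivial (EuclideanSpace ℝ n) with hs | hn
  · refine ⟨1, one_pos, fun x => ?_⟩
    rw [Subsingleton.elim x 0]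
    simp
  have hcont : Continuous fun x : EuclideanSpace ℝ n => ⟪x, Matrix.toEuclideanLin A x⟫ :=
    continuous_id.inner (LinearMap.continuous_of_finiteDimensional _)
  obtain ⟨x₀, hx₀, hmin⟩ := (isCompact_sphere (0 : EuclideanSpace ℝ n) 1).exists_isMinOn
    (NormedSpace.sphere_nonempty.2 zero_le_one) hcont.continuousOn
  have hx₀' : x₀ ≠ 0 := by
    rintro rfl
    simp at hx₀
  refine ⟨_, hpos x₀ hx₀', fun x => ?_⟩
  rcases eq_or_ne x 0 with rfl | hx
  · simp
  have hnx : 0 < ‖x‖ := norm_pos_iff.2 hx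
  have h1 := hmin (a := ‖x‖⁻¹ • x) (by simp [norm_smul, hnx.ne'])
  simp only [Set.mem_ofPred_eq, map_smul, inner_smul_left, inner_smul_right,
    RCLike.conj_to_real] at h1
  calc _ ≤ ‖x‖⁻¹ * (‖x‖⁻¹ * ⟪x, Matrix.toEuclideanLin A x⟫) * ‖x‖ ^ 2 := by gcongr
    _ = _ := by field_simp

theorem Matrix.inner_toEuclideanLin_left {m n : Type*} [Fintype m] [DecidableEq m] [Fintype n]
    [DecidableEq n] (A : Matrix m n ℝ) (x : EuclideanSpace ℝ n) (y : EuclideanSpace ℝ m) :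
    ⟪Matrix.toEuclideanLin A x, y⟫ = ⟪x, Matrix.toEuclideanLin Aᵀ y⟫ := by
  rw [← Matrix.conjTranspose_eq_transpose_of_trivial,
    Matrix.toEuclideanLin_conjTranspose_eq_adjoint, LinearMap.adjoint_inner_right]

theorem Matrix.toEuclideanLin_mul_apply {l m n : Type*} [Fintype m] [DecidableEq m] [Fintype n]
    [DecidableEq n] (A : Matrix l m ℝ) (B : Matrix m n ℝ) (x : EuclideanSpace ℝ n) :
    Matrix.toEuclideanLin (A * B) x = Matrix.toEuclideanLin A (Matrix.toEuclideanLin B x) := by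
  simp [Matrix.toLpLin_apply]

section Blocks

variable {n₂ : ℕ} {r : Fin n₂ → ℕ}

theorem MMat_add (v w : EuclideanSpace ℝ (BIdx r)) : MMat (v + w) = MMat v + MMat w := by
  ext i a
  by_cases h : a.1 = i <;> simp [MMat, h]

theorem MMat_smul (c : ℝ) (v : EuclideanSpace ℝ (BIdx r)) : MMat (c • v) = c • MMat v := by
  ext i a
  by_cases h : a.1 = i <;> simp [MMat, h]

theorem IsBlkDiag.inv {T : Matrix (BIdx r) (BIdx r) ℝ} (hT : IsBlkDiag T) (hu : IsUnit T) :
    IsBlkDiag T⁻¹ := by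
  have hdet := (Matrix.isUnit_iff_isUnit_det T).1 hu
  set D : Matrix (BIdx r) (BIdx r) ℝ := Matrix.diagonal fun a => ((a.1 : ℕ) : ℝ) with hD
  have hcomm : D * T = T * D := by
    ext a b
    rw [hD, Matrix.diagonal_mul, Matrix.mul_diagonal]
    by_cases h : a.1 = b.1
    · rw [h, mul_comm]
    · rw [hT a b h, mul_zero, zero_mul]
  have hinv : T⁻¹ * D = D * T⁻¹ := by
    calc T⁻¹ * D = T⁻¹ * (D * T) * T⁻¹ := by
          rw [mul_assoc, mul_assoc, Matrix.mul_nonsing_inv _ hdet, mul_one]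
      _ = D * T⁻¹ := by
          rw [hcomm, ← mul_assoc, Matrix.nonsing_inv_mul _ hdet, one_mul]
  intro a b hab
  have h := congrFun (congrFun hinv a) b
  rw [hD, Matrix.diagonal_mul, Matrix.mul_diagonal] at h
  have hne : ((b.1 : ℕ) : ℝ) - ((a.1 : ℕ) : ℝ) ≠ 0 := by
    exact sub_ne_zero.2 fun h' => hab (Fin.ext (Nat.cast_injective h')).symm
  refine (mul_eq_zero.1 (?_ : _ * (((b.1 : ℕ) : ℝ) - ((a.1 : ℕ) : ℝ)) = 0)).resolve_right hne
  linarith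

theorem IsBlkRow.mul {Γ : Matrix (Fin n₂) (BIdx r) ℝ} {A : Matrix (BIdx r) (BIdx r) ℝ}
    (hΓ : IsBlkRow Γ) (hA : IsBlkDiag A) : IsBlkRow (Γ * A) := by
  intro j a hja
  rw [Matrix.mul_apply]
  refine Finset.sum_eq_zero fun b _ => ?_
  by_cases h : j = b.1
  · rw [hA b a (h ▸ hja), mul_zero]
  · rw [hΓ j b h, zero_mul]

theorem IsBlkRow.toEuclideanLin_apply {Ψ : Matrix (Fin n₂) (BIdx r) ℝ} (hΨ : IsBlkRow Ψ)
    (v : EuclideanSpace ℝ (BIdx r)) :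
    Matrix.toEuclideanLin Ψ v = Matrix.toEuclideanLin (MMat v) (CVec Ψ) := by
  ext j
  simp only [Matrix.toLpLin_apply, Matrix.mulVec, dotProduct, MMat, CVec, Matrix.of_apply]
  refine Finset.sum_congr rfl fun a _ => ?_
  by_cases h : a.1 = j
  · simp [h, mul_comm]
  · simp [h, hΨ j a (Ne.symm h)]

/-- The bilinear map `(v, w) ↦ 𝓜(v) w`. -/
noncomputable def regressorMap (r : Fin n₂ → ℕ) :
    EuclideanSpace ℝ (BIdx r) →L[ℝ] EuclideanSpace ℝ (BIdx r) →L[ℝ] EuclideanSpace ℝ (Fin n₂) :=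
  (LinearMap.mk₂ ℝ (fun v w => Matrix.toEuclideanLin (MMat v) w)
    (fun v v' w => by simp [MMat_add]) (fun c v w => by simp [MMat_smul])
    (fun v w w' => by simp) (fun c v w => by simp)).toContinuousBilinearMap

/-- The bilinear map `(v, x) ↦ Λ 𝓜(v)ᵀ P x`. -/
noncomputable def adaptationMap (Λ : Matrix (BIdx r) (BIdx r) ℝ)
    (P : Matrix (Fin n₂) (Fin n₂) ℝ) :
    EuclideanSpace ℝ (BIdx r) →L[ℝ] EuclideanSpace ℝ (Fin n₂) →L[ℝ] EuclideanSpace ℝ (BIdx r) :=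
  (LinearMap.mk₂ ℝ (fun v x => Matrix.toEuclideanLin (Λ * (MMat v)ᵀ * P) x)
    (fun v v' w => by simp [MMat_add, Matrix.mul_add, Matrix.add_mul])
    (fun c v w => by simp [MMat_smul])
    (fun v w w' => by simp) (fun c v w => by simp)).toContinuousBilinearMap

theorem regressorMap_apply (v w : EuclideanSpace ℝ (BIdx r)) :
    regressorMap r v w = Matrix.toEuclideanLin (MMat v) w := rfl

theorem adaptationMap_apply (Λ : Matrix (BIdx r) (BIdx r) ℝ) (P : Matrix (Fin n₂) (Fin n₂) ℝ)
    (v : EuclideanSpace ℝ (BIdx r)) (x : EuclideanSpace ℝ (Fin n₂)) :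
    adaptationMap Λ P v x = Matrix.toEuclideanLin (Λ * (MMat v)ᵀ * P) x := rfl

end Blocks

/-- Asymptotic convergence of the adaptive disturbance observer:
`xhat₂ − x₂ → 0` and `d̂ − d → 0`. -/
theorem stmt3 {n₂ : ℕ} (r : Fin n₂ → ℕ) (hr : ∀ i, 0 < r i)
    (M Φ T : Matrix (BIdx r) (BIdx r) ℝ)
    (N : Matrix (BIdx r) (Fin n₂) ℝ) (Γ : Matrix (Fin n₂) (BIdx r) ℝ)
    (hMblk : IsBlkDiag M) (hΦblk : IsBlkDiag Φ) (hTblk : IsBlkDiag T)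
    (hNblk : IsBlkCol N) (hΓblk : IsBlkRow Γ)
    (hM : Hurwitz M) (hT : IsUnit T) (hSyl : T * Φ - M * T = N * Γ)
    (K P : Matrix (Fin n₂) (Fin n₂) ℝ) (Λ : Matrix (BIdx r) (BIdx r) ℝ)
    (hK : Hurwitz K) (hP : P.PosDef) (hPsymm : P.IsSymm)
    (hKP : Kᵀ * P + P * K = -1)
    (hΛ : Λ.PosDef) (hΛsymm : Λ.IsSymm)
    (g : ℝ → EuclideanSpace ℝ (Fin n₂)) (hg : ContinuousOn g (Set.Ici 0))
    (ϱ η θ : ℝ → EuclideanSpace ℝ (BIdx r))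
    (x₂ xhat₂ : ℝ → EuclideanSpace ℝ (Fin n₂))
    (hϱ : ∀ t ≥ (0:ℝ), HasDerivAt ϱ (Matrix.toEuclideanLin (T * Φ * T⁻¹) (ϱ t)) t)
    (hϱbdd : ∃ C, ∀ t ≥ (0:ℝ), ‖ϱ t‖ ≤ C ∧
      ‖Matrix.toEuclideanLin (T * Φ * T⁻¹) (ϱ t)‖ ≤ C)
    (hx₂ : ∀ t ≥ (0:ℝ), HasDerivAt x₂
      (g t - Matrix.toEuclideanLin (Γ * T⁻¹) (ϱ t)) t)
    (hη : ∀ t ≥ (0:ℝ), HasDerivAt η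
      (Matrix.toEuclideanLin M (η t) + Matrix.toEuclideanLin N (g t)
        - Matrix.toEuclideanLin (M * N) (x₂ t)) t)
    (hxhat₂ : ∀ t ≥ (0:ℝ), HasDerivAt xhat₂
      (g t - Matrix.toEuclideanLin (MMat (η t - Matrix.toEuclideanLin N (x₂ t))) (θ t)
        + Matrix.toEuclideanLin K (xhat₂ t - x₂ t)) t)
    (hθ : ∀ t ≥ (0:ℝ), HasDerivAt θ
      (Matrix.toEuclideanLin
        (Λ * (MMat (η t - Matrix.toEuclideanLin N (x₂ t)))ᵀ * P) (xhat₂ t - x₂ t)) t) :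
    Tendsto (fun t => xhat₂ t - x₂ t) atTop (nhds 0) ∧
    Tendsto (fun t =>
        (-(Matrix.toEuclideanLin (MMat (η t - Matrix.toEuclideanLin N (x₂ t))) (θ t)))
          - (-(Matrix.toEuclideanLin (Γ * T⁻¹) (ϱ t)))) atTop (nhds 0) := by
  have hdetT := (Matrix.isUnit_iff_isUnit_det T).1 hT
  have hdetΛ := (Matrix.isUnit_iff_isUnit_det Λ).1 hΛ.isUnit
  set Ψ : Matrix (Fin n₂) (BIdx r) ℝ := Γ * T⁻¹ with hΨ
  have hΨblk : IsBlkRow Ψ := hΓblk.mul (hTblk.inv hT)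
  have hgen : T * Φ * T⁻¹ = M + N * Ψ := by
    rw [sub_eq_iff_eq_add.1 hSyl, add_mul, hΨ, mul_assoc M, Matrix.mul_nonsing_inv _ hdetT,
      mul_one, Matrix.mul_assoc N, add_comm]
  set σ : ℝ → EuclideanSpace ℝ (BIdx r) := fun t => η t - Matrix.toEuclideanLin N (x₂ t) with hσ
  have hζ : ∀ t ≥ (0:ℝ), HasDerivAt (fun s => σ s - ϱ s)
      (Matrix.toEuclideanLin M (σ t - ϱ t)) t := by
    intro t ht
    have h1 := (Matrix.toEuclideanLin N).toContinuousLinearMap.hasFDerivAt.comp_hasDerivAt t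
      (hx₂ t ht)
    refine (((hη t ht).sub h1).sub (hϱ t ht)).congr_deriv ?_
    rw [hgen]
    simp only [hσ, LinearMap.coe_toContinuousLinearMap', map_sub, map_add, LinearMap.add_apply,
      Matrix.toEuclideanLin_mul_apply]
    abel
  obtain ⟨a, ha, c, hc⟩ := hM.exists_norm_le_exp hζ
  obtain ⟨C, hC⟩ := hϱbdd
  have hϱl : BddLip ϱ := .of_hasDerivAt hϱ (fun t ht => (hC t ht).1) (fun t ht => (hC t ht).2)
  have hc0 : 0 ≤ c := by simpa using (norm_nonneg _).trans (hc 0 le_rfl)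
  have hcb : ∀ t ≥ (0:ℝ), ‖σ t - ϱ t‖ ≤ c := fun t ht => (hc t ht).trans
    (mul_le_of_le_one_right hc0 (Real.exp_le_one_iff.2 (by nlinarith)))
  have hζl : BddLip fun t => σ t - ϱ t := .of_hasDerivAt hζ hcb
    fun t ht => (Matrix.toEuclideanLin M).toContinuousLinearMap.le_of_opNorm_le_of_le le_rfl
      (hcb t ht)
  have hσl : BddLip σ := by simpa using hζl.add hϱl
  obtain ⟨p, hp, hPpos⟩ := hP.exists_mul_sq_norm_le_inner
  obtain ⟨q, hq, hGpos⟩ := hΛ.inv.exists_mul_sq_norm_le_inner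
  have hGsymm : Λ⁻¹ᵀ = Λ⁻¹ := by rw [Matrix.transpose_nonsing_inv, hΛsymm.eq]
  have hΨσ : ∀ t, Matrix.toEuclideanLin Ψ (ϱ t) = Matrix.toEuclideanLin (MMat (σ t)) (CVec Ψ)
      - Matrix.toEuclideanLin Ψ (σ t - ϱ t) := by
    intro t
    rw [← hΨblk.toEuclideanLin_apply, ← map_sub, sub_sub_cancel]
  obtain ⟨h1, h2⟩ := tendsto_zero_of_adaptive_error (regressorMap r) (adaptationMap Λ P)
    (Matrix.toEuclideanLin Ψ).toContinuousLinearMap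
    (Matrix.toEuclideanLin K).toContinuousLinearMap
    (Matrix.toEuclideanLin P).toContinuousLinearMap
    (Matrix.toEuclideanLin Λ⁻¹).toContinuousLinearMap hp hq ha hPpos
    (fun x y => by
      simp only [LinearMap.coe_toContinuousLinearMap']
      rw [Matrix.inner_toEuclideanLin_left, hPsymm.eq])
    hGpos
    (fun x y => by
      simp only [LinearMap.coe_toContinuousLinearMap']
      rw [Matrix.inner_toEuclideanLin_left, hGsymm])
    (fun x => by
      simp only [LinearMap.coe_toContinuousLinearMap']
      have h := congrArg (fun A => ⟪x, Matrix.toEuclideanLin A x⟫) hKP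
      simp only [map_add, map_neg, LinearMap.add_apply, LinearMap.neg_apply,
        Matrix.toEuclideanLin_mul_apply, inner_add_right, inner_neg_right,
        ← Matrix.inner_toEuclideanLin_left] at h
      have h3 : ⟪x, Matrix.toEuclideanLin P (Matrix.toEuclideanLin K x)⟫
          = ⟪Matrix.toEuclideanLin P x, Matrix.toEuclideanLin K x⟫ := by
        rw [Matrix.inner_toEuclideanLin_left, hPsymm.eq]
      have h4 : Matrix.toEuclideanLin (1 : Matrix (Fin n₂) (Fin n₂) ℝ) x = x := by
        simp
      rw [h3, h4, real_inner_self_eq_norm_sq, real_inner_comm] at h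
      linarith)
    (fun v x w => by
      rw [adaptationMap_apply, regressorMap_apply]
      simp only [LinearMap.coe_toContinuousLinearMap']
      rw [Matrix.inner_toEuclideanLin_left, Matrix.inner_toEuclideanLin_left, hGsymm,
        ← Matrix.toEuclideanLin_mul_apply, ← Matrix.toEuclideanLin_mul_apply, Matrix.mul_assoc Λ,
        ← Matrix.mul_assoc, Matrix.nonsing_inv_mul _ hdetΛ, Matrix.one_mul])
    (σ := σ) (θ := fun t => θ t - CVec Ψ) (ζ := fun t => σ t - ϱ t)
    (e := fun t => xhat₂ t - x₂ t) hσl hζl hc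
    (fun t ht => by
      refine ((hxhat₂ t ht).sub (hx₂ t ht)).congr_deriv ?_
      rw [hΨσ, regressorMap_apply]
      simp only [LinearMap.coe_toContinuousLinearMap', map_sub (Matrix.toEuclideanLin (MMat _))]
      abel)
    (fun t ht => (hθ t ht).sub_const _)
  refine ⟨h1, ?_⟩
  have h3 := h2.neg
  rw [neg_zero] at h3
  refine h3.congr fun t => ?_
  rw [hΨσ, regressorMap_apply]
  simp only [LinearMap.coe_toContinuousLinearMap', map_sub (Matrix.toEuclideanLin (MMat _))]
  abel
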